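/- For every integer l ≥ 5 and every u ∈ ℝ^{V0}, the minimum of ∑_{i∈S_l} E⁰(v∘f^l_i|_{V0}, v∘f^l_i|_{V0}) over all v ∈ ℝ^{V^l_1} with v|_{V0} = u is attained and equals r_l · E⁰(u,u), where r_l := (2l/3 + 1/9)⁻¹. -/

import Mathlib

open scoped BigOperators ENNReal
open Set Filter MeasureTheory

noncomputable section

abbrev E2 : Type := EuclideanSpace ℝ (Fin 2)

/-- The index set `S_l` of the level-`l` thin Sierpinski gasket. -/
def Sset (l : ℕ) : Set (ℕ × ℕ) :=
  {p | p.1 + p.2 ≤ l - 1 ∧ p.1 * p.2 * (l - 1 - p.1 - p.2) = 0}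

/-- The contraction `f^l_i`. -/
def fmap (q : Fin 3 → E2) (l : ℕ) (i : ℕ × ℕ) (x : E2) : E2 :=
  q 0 + ((i.1 : ℝ) / l) • (q 1 - q 0) + ((i.2 : ℝ) / l) • (q 2 - q 0)
    + (l : ℝ)⁻¹ • (x - q 0)

/-- The closed equilateral triangle `△`. -/
def Tri (q : Fin 3 → E2) : Set E2 := convexHull ℝ (Set.range q)

def V0 (q : Fin 3 → E2) : Set E2 := Set.range q

/-- Words of length `n` (padded by `(0,0)` beyond position `n`). -/
def Wn (l : ℕ → ℕ) (n : ℕ) : Set (ℕ → ℕ × ℕ) :=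
  {w | (∀ k, k < n → w k ∈ Sset (l k)) ∧ ∀ k, n ≤ k → w k = (0, 0)}

/-- `wordMap q l w n = f^{l_1}_{w_1} ∘ ⋯ ∘ f^{l_n}_{w_n}` (0-indexed). -/
def wordMap (q : Fin 3 → E2) (l : ℕ → ℕ) (w : ℕ → ℕ × ℕ) : ℕ → E2 → E2
  | 0 => id
  | n + 1 => wordMap q l w n ∘ fmap q (l n) (w n)

/-- The thin scale irregular Sierpinski gasket `K`. -/
def Gasket (q : Fin 3 → E2) (l : ℕ → ℕ) : Set E2 :=
  ⋂ n, ⋃ w ∈ Wn l n, wordMap q l w n '' Tri q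

/-- The cell `K_w = K ∩ f_w(△)`. -/
def Cell (q : Fin 3 → E2) (l : ℕ → ℕ) (n : ℕ) (w : ℕ → ℕ × ℕ) : Set E2 :=
  Gasket q l ∩ wordMap q l w n '' Tri q

def Vn (q : Fin 3 → E2) (l : ℕ → ℕ) (n : ℕ) : Set E2 :=
  ⋃ w ∈ Wn l n, wordMap q l w n '' V0 q

def Vstar (q : Fin 3 → E2) (l : ℕ → ℕ) : Set E2 := ⋃ n, Vn q l n

def Ln (l : ℕ → ℕ) (n : ℕ) : ℕ := ∏ k ∈ Finset.range n, l k

def Mn (l : ℕ → ℕ) (n : ℕ) : ℕ := ∏ k ∈ Finset.range n, (3 * l k - 3)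

def rl (l : ℕ) : ℝ := (2 * (l : ℝ) / 3 + 1 / 9)⁻¹

def Rn (l : ℕ → ℕ) (n : ℕ) : ℝ := ∏ k ∈ Finset.range n, rl (l k)

def Tn (l : ℕ → ℕ) (n : ℕ) : ℝ := (Mn l n : ℝ) / Rn l n

/-- The basic energy form `E⁰` on `ℝ^{V₀}`. -/
def E0 (q : Fin 3 → E2) (u v : E2 → ℝ) : ℝ :=
  (1 / 2) * ∑ j : Fin 3, ∑ k : Fin 3, (u (q j) - u (q k)) * (v (q j) - v (q k))

/-- The level-`n` energy form `Eⁿ`. -/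
def En (q : Fin 3 → E2) (l : ℕ → ℕ) (n : ℕ) (u v : E2 → ℝ) : ℝ :=
  (Rn l n)⁻¹ * ∑ᶠ w ∈ Wn l n, E0 q (u ∘ wordMap q l w n) (v ∘ wordMap q l w n)

/-- The domain `F` of the limit resistance form. -/
def FDom (q : Fin 3 → E2) (l : ℕ → ℕ) : Set (E2 → ℝ) :=
  {u | ∃ C : ℝ, ∀ n, En q l n u u ≤ C}

/-- The limit form `E(u,v) = lim_n Eⁿ(u,v)`. -/
def EForm (q : Fin 3 → E2) (l : ℕ → ℕ) (u v : E2 → ℝ) : ℝ :=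
  limUnder atTop fun n => En q l n u v

/-- The intrinsic (geodesic) distance on `K`, with values in `ℝ≥0∞`. -/
def pdist (q : Fin 3 → E2) (l : ℕ → ℕ) (x y : E2) : ℝ≥0∞ :=
  ⨅ (γ : ℝ → E2) (_ : ContinuousOn γ (Set.Icc 0 1))
    (_ : Set.MapsTo γ (Set.Icc 0 1) (Gasket q l)) (_ : γ 0 = x) (_ : γ 1 = y),
    eVariationOn γ (Set.Icc 0 1)

def gdist (q : Fin 3 → E2) (l : ℕ → ℕ) (x y : E2) : ℝ := (pdist q l x y).toReal

/-- The set of resistance quotients used to define `R_E`. -/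
def REset (q : Fin 3 → E2) (l : ℕ → ℕ) (x y : E2) : Set ℝ :=
  {t | ∃ u ∈ FDom q l, 0 < EForm q l u u ∧ t = (u x - u y) ^ 2 / EForm q l u u}

/-- The resistance metric `R_E`. -/
def RE (q : Fin 3 → E2) (l : ℕ → ℕ) (x y : E2) : ℝ := sSup (REset q l x y)

/-- Resistance quotients over continuous representatives (i.e. `F` viewed in `C(K)`). -/
def REcSet (q : Fin 3 → E2) (l : ℕ → ℕ) (x y : E2) : Set ℝ :=
  {t | ∃ u ∈ FDom q l, ContinuousOn u (Gasket q l) ∧ 0 < EForm q l u u ∧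
    t = (u x - u y) ^ 2 / EForm q l u u}

def REc (q : Fin 3 → E2) (l : ℕ → ℕ) (x y : E2) : ℝ := sSup (REcSet q l x y)

/-- The open `d`-ball in `K`. -/
def Bd (q : Fin 3 → E2) (l : ℕ → ℕ) (x : E2) (s : ℝ) : Set E2 :=
  {y ∈ Gasket q l | gdist q l x y < s}

/-- The open `R_E`-ball in `K`. -/
def BRc (q : Fin 3 → E2) (l : ℕ → ℕ) (x : E2) (s : ℝ) : Set E2 :=
  {y ∈ Gasket q l | REc q l x y < s}

/-- `Λ^{(k)}_{n,w}`: words within `k` cell-steps of `w`. -/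
def Lam (q : Fin 3 → E2) (l : ℕ → ℕ) (n : ℕ) (w : ℕ → ℕ × ℕ) (k : ℕ) :
    Set (ℕ → ℕ × ℕ) :=
  {v ∈ Wn l n | ∃ c : ℕ → ℕ → ℕ × ℕ, c 0 = w ∧ c k = v ∧ (∀ j ≤ k, c j ∈ Wn l n) ∧
    ∀ j < k, (Cell q l n (c j) ∩ Cell q l n (c (j + 1))).Nonempty}

/-- `U^{(k)}_{n,w}`. -/
def Unwk (q : Fin 3 → E2) (l : ℕ → ℕ) (n : ℕ) (w : ℕ → ℕ × ℕ) (k : ℕ) : Set E2 :=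
  ⋃ v ∈ Lam q l n w k, Cell q l n v

def betaZero (l : ℕ → ℕ) : ℝ :=
  ⨅ n : ℕ, Real.logb (l n) (2 * (l n : ℝ) ^ 2 - (5 / 3) * (l n : ℝ) - 1 / 3)

def betaOne (l : ℕ → ℕ) : ℝ :=
  ⨆ n : ℕ, Real.logb (l n) (2 * (l n : ℝ) ^ 2 - (5 / 3) * (l n : ℝ) - 1 / 3)

def betaM (l : ℕ → ℕ) : ℝ := ⨅ n : ℕ, Real.logb (l n) (3 * (l n : ℝ) - 3)

def betaR (l : ℕ → ℕ) : ℝ := ⨆ n : ℕ, Real.logb (l n) ((rl (l n))⁻¹)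

/-- The value of `Ψ` on the interval `[1/L_{n+1}, 1/L_n]`. -/
def psiPiece (l : ℕ → ℕ) (n : ℕ) (s : ℝ) : ℝ :=
  (Tn l (n + 1))⁻¹
    * (1 + ((3 * (l n : ℝ) - 4) / ((l n : ℝ) - 1)) * ((Ln l (n + 1) : ℝ) * s - 1))
    * (1 + (((2 / 3) * (l n : ℝ) - 8 / 9) / ((l n : ℝ) - 1)) * ((Ln l (n + 1) : ℝ) * s - 1))

/-- `Ψ = Ψ_𝒍` is characterized by these defining clauses. -/
def IsPsi (l : ℕ → ℕ) (Psi : ℝ → ℝ) : Prop :=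
  (∀ n : ℕ, ∀ s : ℝ, ((Ln l (n + 1) : ℝ))⁻¹ ≤ s → s ≤ ((Ln l n : ℝ))⁻¹ →
      Psi s = psiPiece l n s) ∧
  (∀ s : ℝ, 1 ≤ s → Psi s = s ^ betaZero l) ∧ Psi 0 = 0

def psiMPiece (l : ℕ → ℕ) (n : ℕ) (s : ℝ) : ℝ :=
  ((Mn l (n + 1) : ℝ))⁻¹
    * (1 + ((3 * (l n : ℝ) - 4) / ((l n : ℝ) - 1)) * ((Ln l (n + 1) : ℝ) * s - 1))

def IsPsiM (l : ℕ → ℕ) (PsiM : ℝ → ℝ) : Prop :=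
  (∀ n : ℕ, ∀ s : ℝ, ((Ln l (n + 1) : ℝ))⁻¹ ≤ s → s ≤ ((Ln l n : ℝ))⁻¹ →
      PsiM s = psiMPiece l n s) ∧
  (∀ s : ℝ, 1 ≤ s → PsiM s = s ^ betaM l) ∧ PsiM 0 = 0

def psiRPiece (l : ℕ → ℕ) (n : ℕ) (s : ℝ) : ℝ :=
  Rn l (n + 1)
    * (1 + (((2 / 3) * (l n : ℝ) - 8 / 9) / ((l n : ℝ) - 1)) * ((Ln l (n + 1) : ℝ) * s - 1))

def IsPsiR (l : ℕ → ℕ) (PsiR : ℝ → ℝ) : Prop :=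
  (∀ n : ℕ, ∀ s : ℝ, ((Ln l (n + 1) : ℝ))⁻¹ ≤ s → s ≤ ((Ln l n : ℝ))⁻¹ →
      PsiR s = psiRPiece l n s) ∧
  (∀ s : ℝ, 1 ≤ s → PsiR s = s ^ betaR l) ∧ PsiR 0 = 0

/-- `μ` is the uniform distribution on `K`: a Borel measure carried by `K`
with `μ(K_w) = 1/M_{|w|}` for every word `w`. -/
def IsUnif (q : Fin 3 → E2) (l : ℕ → ℕ) (μ : Measure E2) : Prop :=
  μ (Gasket q l)ᶜ = 0 ∧ ∀ n : ℕ, ∀ w ∈ Wn l n, μ (Cell q l n w) = ((Mn l n : ℝ≥0∞))⁻¹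

/-- `μ` is the energy measure of `u`: a Borel measure carried by `K` with
`μ(K_w) = R_{|w|}⁻¹ E^{𝒍^{|w|}}(u∘F_w, u∘F_w)` for every word `w`. -/
def IsEnergyMeasure (q : Fin 3 → E2) (l : ℕ → ℕ) (u : E2 → ℝ) (μ : Measure E2) : Prop :=
  μ (Gasket q l)ᶜ = 0 ∧ ∀ n : ℕ, ∀ w ∈ Wn l n,
    μ (Cell q l n w) = ENNReal.ofReal ((Rn l n)⁻¹ *
      EForm q (fun k => l (k + n)) (u ∘ wordMap q l w n) (u ∘ wordMap q l w n))


/-- The triangle energy. -/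
def TT (x y z : ℝ) : ℝ := (x - y) ^ 2 + (y - z) ^ 2 + (x - z) ^ 2

theorem TT_nonneg (x y z : ℝ) : 0 ≤ TT x y z := by unfold TT; positivity

/-- Energy of the corner. -/
theorem corner_bound (u x y p r z : ℝ) :
    3 / 5 * TT u x y ≤ TT u p r + TT p x z + TT r y z := by
  have h : TT u p r + TT p x z + TT r y z - 3 / 5 * TT u x y =
      TT (p - (2 * u + 2 * x + y) / 5) (r - (2 * u + 2 * y + x) / 5) (z - (2 * x + 2 * y + u) / 5)
      + 2 * (p - (2 * u + 2 * x + y) / 5) ^ 2 + 2 * (r - (2 * u + 2 * y + x) / 5) ^ 2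
      + 2 * (z - (2 * x + 2 * y + u) / 5) ^ 2 := by
    unfold TT; ring
  have := TT_nonneg (p - (2 * u + 2 * x + y) / 5) (r - (2 * u + 2 * y + x) / 5)
    (z - (2 * x + 2 * y + u) / 5)
  nlinarith [sq_nonneg (p - (2 * u + 2 * x + y) / 5), sq_nonneg (r - (2 * u + 2 * y + x) / 5),
    sq_nonneg (z - (2 * x + 2 * y + u) / 5)]

theorem chain_bound (x z : ℕ → ℝ) (c : ℝ) (n : ℕ) :
    3 / 2 * (2 * c * (x 0 - x n) - n * c ^ 2) ≤
      ∑ j ∈ Finset.range n, TT (x j) (x (j + 1)) (z j) := by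
  induction n with
  | zero => simp
  | succ n ih =>
    rw [Finset.sum_range_succ]
    push_cast
    have : 3 / 2 * (2 * c * (x n - x (n + 1)) - c ^ 2) ≤ TT (x n) (x (n + 1)) (z n) := by
      unfold TT
      nlinarith [sq_nonneg (x n - x (n + 1) - c), sq_nonneg (x n + x (n + 1) - 2 * z n)]
    nlinarith

theorem TT_tangent (a b c x y z : ℝ) :
    2 * ((a - b) * (x - y) + (b - c) * (y - z) + (a - c) * (x - z)) - TT a b c ≤ TT x y z := by
  have := TT_nonneg (x - a) (y - b) (z - c)
  unfold TT at *
  nlinarith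

theorem final_bound (n u0 u1 u2 a01 a02 a10 a12 a20 a21 s01 s02 s12 : ℝ) (hn : 0 ≤ n)
    (h01 : ∀ c, 3 / 2 * (2 * c * (a01 - a10) - n * c ^ 2) ≤ s01)
    (h02 : ∀ c, 3 / 2 * (2 * c * (a02 - a20) - n * c ^ 2) ≤ s02)
    (h12 : ∀ c, 3 / 2 * (2 * c * (a21 - a12) - n * c ^ 2) ≤ s12) :
    9 / (6 * n + 25) * TT u0 u1 u2 ≤
      3 / 5 * TT u0 a01 a02 + 3 / 5 * TT u1 a10 a12 + 3 / 5 * TT u2 a20 a21 + s01 + s02 + s12 := by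
  obtain ⟨k, hk⟩ : ∃ k, k = (6 * n + 25)⁻¹ := ⟨_, rfl⟩
  have hk' : n * k = (1 - 25 * k) / 6 := by
    rw [hk]; field_simp; ring
  have e0 := TT_tangent 0 (k * 5 * (2 * (u1 - u0) + (u2 - u0))) (k * 5 * (2 * (u2 - u0) + (u1 - u0)))
    u0 a01 a02
  have e1 := TT_tangent 0 (k * 5 * (2 * (u0 - u1) + (u2 - u1))) (k * 5 * (2 * (u2 - u1) + (u0 - u1)))
    u1 a10 a12
  have e2 := TT_tangent 0 (k * 5 * (2 * (u0 - u2) + (u1 - u2))) (k * 5 * (2 * (u1 - u2) + (u0 - u2)))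
    u2 a20 a21
  have f01 := h01 (6 * k * (u0 - u1))
  have f02 := h02 (6 * k * (u0 - u2))
  have f12 := h12 (6 * k * (u2 - u1))
  have g : ∀ t, n * (6 * k * t) ^ 2 = 6 * k * (1 - 25 * k) * t ^ 2 := by
    intro t
    linear_combination (36 * k * t ^ 2) * hk'
  rw [g] at f01 f02 f12
  have : (9 : ℝ) / (6 * n + 25) = 9 * k := by rw [hk]; rfl
  rw [this]
  clear this g hk hk' h01 h02 h12
  unfold TT at *
  linarith

/-- Weight of the harmonic extension. -/
def GG (l a b c : ℕ) : ℝ :=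
  if a = 0 then (if b = 0 ∨ c = 0 then 0 else if b = 1 ∨ c = 1 then 4 else 5)
  else if b = 0 ∨ c = 0 then
    (if a = 1 then 5 else if a = l then 6 * (l : ℝ) + 1 else 6 * (a : ℝ) - 2)
  else if a = 1 then (if b = 1 ∨ c = 1 then 6 else 5)
  else 6 * (a : ℝ) + 1

def WW (l : ℕ) (u0 u1 u2 : ℝ) (p : ℕ × ℕ) : ℝ :=
  u0 + (GG l p.1 p.2 (l - p.1 - p.2) * (u1 - u0) + GG l p.2 p.1 (l - p.1 - p.2) * (u2 - u0))
    / (6 * (l : ℝ) + 1)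

/-- energy of a cell -/
def CE (w : ℕ × ℕ → ℝ) (p : ℕ × ℕ) : ℝ := TT (w p) (w (p.1 + 1, p.2)) (w (p.1, p.2 + 1))

def SF (m : ℕ) : Finset (ℕ × ℕ) :=
  ({(0,0), (1,0), (0,1), (m+4,0), (m+3,0), (m+3,1), (0,m+4), (0,m+3), (1,m+3)} : Finset (ℕ × ℕ)) ∪
  ((Finset.range (m+1)).image (fun j => (j+2, 0)) ∪
  ((Finset.range (m+1)).image (fun j => (0, j+2)) ∪
  (Finset.range (m+1)).image (fun j => (j+2, m+2-j))))

theorem SF_eq (m : ℕ) : (SF m : Set (ℕ × ℕ)) = Sset (m + 5) := by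
  ext ⟨a, b⟩
  simp only [SF, Sset, Finset.coe_union, Finset.coe_image, Finset.coe_insert, Finset.coe_singleton,
    Set.mem_union, Set.mem_insert_iff, Set.mem_singleton_iff, Set.mem_image, Finset.coe_range,
    Set.mem_Iio, Prod.mk.injEq, Set.mem_ofPred_eq, mul_eq_zero]
  constructor
  · rintro (h | ⟨j, hj, h⟩ | ⟨j, hj, h⟩ | ⟨j, hj, h⟩) <;> omega
  · rintro ⟨h1, h2⟩
    by_cases hA : b = 0 ∧ 2 ≤ a ∧ a ≤ m + 2
    · right; left; exact ⟨a - 2, by omega, by omega, by omega⟩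
    by_cases hB : a = 0 ∧ 2 ≤ b ∧ b ≤ m + 2
    · right; right; left; exact ⟨b - 2, by omega, by omega, by omega⟩
    by_cases hC : a + b = m + 4 ∧ 2 ≤ a ∧ a ≤ m + 2
    · right; right; right; exact ⟨a - 2, by omega, by omega, by omega⟩
    left
    have h3 : (b = 0 ∧ (a = 0 ∨ a = 1 ∨ a = m + 3 ∨ a = m + 4)) ∨
        (a = 0 ∧ (b = 1 ∨ b = m + 3 ∨ b = m + 4)) ∨
        (a = 1 ∧ b = m + 3) ∨ (a = m + 3 ∧ b = 1) := by
      rcases h2 with (h2 | h2) | h2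
      · omega
      · omega
      · have h4 : a + b = m + 4 := by omega
        have h5 : a < 2 ∨ m + 2 < a := by omega
        clear hA hB hC h1 h2
        omega
    clear hA hB hC h1 h2
    rcases h3 with ⟨rfl, rfl | rfl | rfl | rfl⟩ | ⟨rfl, rfl | rfl | rfl⟩ | ⟨rfl, rfl⟩ | ⟨rfl, rfl⟩ <;>
      simp

theorem sum_SF (m : ℕ) (f : ℕ × ℕ → ℝ) : ∑ i ∈ SF m, f i =
    (f (0,0) + f (1,0) + f (0,1)) + (f (m+4,0) + f (m+3,0) + f (m+3,1)) +
    (f (0,m+4) + f (0,m+3) + f (1,m+3)) +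
    ∑ j ∈ Finset.range (m+1), f (j+2,0) + ∑ j ∈ Finset.range (m+1), f (0,j+2) +
    ∑ j ∈ Finset.range (m+1), f (j+2,m+2-j) := by
  unfold SF
  rw [Finset.sum_union, Finset.sum_union, Finset.sum_union, Finset.sum_image, Finset.sum_image,
    Finset.sum_image]
  · rw [Finset.sum_insert, Finset.sum_insert, Finset.sum_insert, Finset.sum_insert,
      Finset.sum_insert, Finset.sum_insert, Finset.sum_insert, Finset.sum_insert,
      Finset.sum_singleton]
    · ring
    all_goals simp
  · intro a _ b _ h; simp at h; omega
  · intro a _ b _ h; simp at h; omega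
  · intro a _ b _ h; simp at h; omega
  · rw [Finset.disjoint_left]
    rintro ⟨a, b⟩ h h'
    simp only [Finset.mem_image, Finset.mem_range, Prod.mk.injEq] at h h'
    obtain ⟨j, hj, h⟩ := h
    obtain ⟨j', hj', h'⟩ := h'
    omega
  · rw [Finset.disjoint_left]
    rintro ⟨a, b⟩ h h'
    simp only [Finset.mem_image, Finset.mem_range, Prod.mk.injEq, Finset.mem_union] at h h'
    obtain ⟨j, hj, h⟩ := h
    obtain ⟨j', hj', h'⟩ | ⟨j', hj', h'⟩ := h' <;> omega
  · rw [Finset.disjoint_left]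
    rintro ⟨a, b⟩ h h'
    simp only [Finset.mem_image, Finset.mem_range, Prod.mk.injEq, Finset.mem_union,
      Finset.mem_insert, Finset.mem_singleton] at h h'
    obtain ⟨j', hj', h'⟩ | ⟨j', hj', h'⟩ | ⟨j', hj', h'⟩ := h' <;> omega

theorem lower (m : ℕ) (w : ℕ × ℕ → ℝ) :
    rl (m + 5) * TT (w (0,0)) (w (m+5,0)) (w (0,m+5)) ≤ ∑ i ∈ SF m, CE w i := by
  rw [sum_SF]
  have hA := fun c => chain_bound (fun j => w (j+2,0)) (fun j => w (j+2,1)) c (m+1)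
  have hB := fun c => chain_bound (fun j => w (0,j+2)) (fun j => w (1,j+2)) c (m+1)
  have hC := fun c => chain_bound (fun j => w (j+2,m+3-j)) (fun j => w (j+2,m+2-j)) c (m+1)
  have sC : ∑ j ∈ Finset.range (m+1), CE w (j+2,m+2-j) = ∑ j ∈ Finset.range (m+1),
      TT (w (j+2,m+3-j)) (w (j+1+2,m+3-(j+1))) (w (j+2,m+2-j)) := by
    refine Finset.sum_congr rfl fun j hj => ?_
    have hj' : j < m + 1 := by simpa using hj
    have h1 : m + 3 - (j + 1) = m + 2 - j := by omega
    have h2 : m + 3 - j = m + 2 - j + 1 := by omega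
    rw [h1, h2]
    simp only [CE, TT]
    ring
  have sA : ∑ j ∈ Finset.range (m+1), CE w (j+2,0) = ∑ j ∈ Finset.range (m+1),
      TT (w (j+2,0)) (w (j+1+2,0)) (w (j+2,1)) := rfl
  have sB : ∑ j ∈ Finset.range (m+1), CE w (0,j+2) = ∑ j ∈ Finset.range (m+1),
      TT (w (0,j+2)) (w (0,j+1+2)) (w (1,j+2)) := by
    refine Finset.sum_congr rfl fun j hj => ?_
    simp only [CE, TT, zero_add, show j + 1 + 2 = j + 2 + 1 by ring]
    ring
  rw [sA, sB, sC]
  have h3 : m + 3 - (m + 1) = 2 := by omega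
  simp only [h3, Nat.sub_zero, zero_add] at hA hB hC
  have key := final_bound ((m + 1 : ℕ) : ℝ) (w (0,0)) (w (m+5,0)) (w (0,m+5)) (w (2,0)) (w (0,2))
    (w (m+1+2,0)) (w (m+1+2,2)) (w (0,m+1+2)) (w (2,m+3)) _ _ _ (by positivity) hA hB hC
  have c0 := corner_bound (w (0,0)) (w (2,0)) (w (0,2)) (w (1,0)) (w (0,1)) (w (1,1))
  have c1 := corner_bound (w (m+5,0)) (w (m+3,0)) (w (m+3,2)) (w (m+4,0)) (w (m+4,1)) (w (m+3,1))
  have c2 := corner_bound (w (0,m+5)) (w (0,m+3)) (w (2,m+3)) (w (0,m+4)) (w (1,m+4)) (w (1,m+3))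
  have hr : rl (m+5) = 9 / (6 * ((m + 1 : ℕ) : ℝ) + 25) := by
    unfold rl; push_cast; field_simp; ring
  rw [hr]
  have i0 : CE w (0,0) + CE w (1,0) + CE w (0,1) = TT (w (0,0)) (w (1,0)) (w (0,1)) +
      TT (w (1,0)) (w (2,0)) (w (1,1)) + TT (w (0,1)) (w (0,2)) (w (1,1)) := by
    simp only [CE, TT, zero_add, Nat.reduceAdd]; ring
  have i1 : CE w (m+4,0) + CE w (m+3,0) + CE w (m+3,1) = TT (w (m+5,0)) (w (m+4,0)) (w (m+4,1)) +
      TT (w (m+4,0)) (w (m+3,0)) (w (m+3,1)) + TT (w (m+4,1)) (w (m+3,2)) (w (m+3,1)) := by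
    simp only [CE, TT, zero_add, Nat.reduceAdd, Nat.add_assoc]; ring
  have i2 : CE w (0,m+4) + CE w (0,m+3) + CE w (1,m+3) = TT (w (0,m+5)) (w (0,m+4)) (w (1,m+4)) +
      TT (w (0,m+4)) (w (0,m+3)) (w (1,m+3)) + TT (w (1,m+4)) (w (2,m+3)) (w (1,m+3)) := by
    simp only [CE, TT, zero_add, Nat.reduceAdd, Nat.add_assoc]; ring
  rw [i0, i1, i2]
  simp only [Nat.add_assoc, Nat.reduceAdd] at key ⊢
  linarith

theorem WW_corner (m : ℕ) (u0 u1 u2 : ℝ) : WW (m+5) u0 u1 u2 (0,0) = u0 ∧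
    WW (m+5) u0 u1 u2 (m+5,0) = u1 ∧ WW (m+5) u0 u1 u2 (0,m+5) = u2 := by
  have : (6 * ((m:ℝ)+5) + 1) ≠ 0 := by positivity
  refine ⟨?_, ?_, ?_⟩ <;> simp [WW, GG] <;> field_simp <;> ring

theorem GG_side (l a b c : ℕ) (h : b = 0 ∨ c = 0) (h2 : 2 ≤ a) (h3 : a < l) :
    GG l a b c = 6 * (a : ℝ) - 2 := by
  unfold GG
  rw [if_neg (by omega), if_pos h, if_neg (by omega), if_neg (by omega)]

theorem GG_zero (l b c : ℕ) (h : 2 ≤ b) (h2 : 2 ≤ c) : GG l 0 b c = 5 := by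
  unfold GG
  rw [if_pos rfl, if_neg (by omega), if_neg (by omega)]

theorem GG_one (l b c : ℕ) (h : 2 ≤ b) (h2 : 2 ≤ c) : GG l 1 b c = 5 := by
  unfold GG
  rw [if_neg (by omega), if_neg (by omega), if_pos rfl, if_neg (by omega)]

theorem GG_int (l a b c : ℕ) (h : 1 ≤ b) (h2 : 1 ≤ c) (h3 : 2 ≤ a) :
    GG l a b c = 6 * (a : ℝ) + 1 := by
  unfold GG
  rw [if_neg (by omega), if_neg (by omega), if_neg (by omega)]

theorem WW_energy (m : ℕ) (u0 u1 u2 : ℝ) :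
    ∑ i ∈ SF m, CE (WW (m+5) u0 u1 u2) i = rl (m + 5) * TT u0 u1 u2 := by
  rw [sum_SF]
  have hM : (6 * ((m:ℝ)+5) + 1) ≠ 0 := by positivity
  have hA : ∀ j ∈ Finset.range (m+1), CE (WW (m+5) u0 u1 u2) (j+2,0) =
      3 / 2 * (6 * (u1 - u0) / (6 * ((m:ℝ)+5) + 1)) ^ 2 := by
    intro j hj
    have hj' : j < m + 1 := Finset.mem_range.mp hj
    simp only [CE, WW]
    rw [GG_side _ (j+2) (0) _ (by omega) (by omega) (by omega),
      GG_side _ (j+2+1) (0) _ (by omega) (by omega) (by omega),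
      GG_zero _ (j+2) _ (by omega) (by omega),
      GG_zero _ (j+2+1) _ (by omega) (by omega),
      GG_int _ (j+2) (0+1) _ (by omega) (by omega) (by omega),
      GG_one _ (j+2) _ (by omega) (by omega)]
    push_cast
    unfold TT
    field_simp
    ring
  have hB : ∀ j ∈ Finset.range (m+1), CE (WW (m+5) u0 u1 u2) (0,j+2) =
      3 / 2 * (6 * (u2 - u0) / (6 * ((m:ℝ)+5) + 1)) ^ 2 := by
    intro j hj
    have hj' : j < m + 1 := Finset.mem_range.mp hj
    simp only [CE, WW]
    rw [GG_side _ (j+2) (0) _ (by omega) (by omega) (by omega),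
      GG_side _ (j+2+1) (0) _ (by omega) (by omega) (by omega),
      GG_zero _ (j+2) _ (by omega) (by omega),
      GG_zero _ (j+2+1) _ (by omega) (by omega),
      GG_int _ (j+2) (0+1) _ (by omega) (by omega) (by omega),
      GG_one _ (j+2) _ (by omega) (by omega)]
    push_cast
    unfold TT
    field_simp
    ring
  have hC : ∀ j ∈ Finset.range (m+1), CE (WW (m+5) u0 u1 u2) (j+2,m+2-j) =
      3 / 2 * (6 * (u2 - u1) / (6 * ((m:ℝ)+5) + 1)) ^ 2 := by
    intro j hj
    have hj' : j < m + 1 := Finset.mem_range.mp hj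
    have hc : ((m + 2 - j : ℕ) : ℝ) = m + 2 - j := by
      rw [Nat.cast_sub (by omega)]; push_cast; ring
    simp only [CE, WW]
    rw [GG_int _ (j+2) (m+2-j) _ (by omega) (by omega) (by omega),
      GG_int _ (m+2-j) (j+2) _ (by omega) (by omega) (by omega),
      GG_side _ (j+2+1) (m+2-j) _ (by omega) (by omega) (by omega),
      GG_side _ (m+2-j) (j+2+1) _ (by omega) (by omega) (by omega),
      GG_side _ (j+2) (m+2-j+1) _ (by omega) (by omega) (by omega),
      GG_side _ (m+2-j+1) (j+2) _ (by omega) (by omega) (by omega)]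
    push_cast
    rw [hc]
    unfold TT
    field_simp
    ring
  rw [Finset.sum_congr rfl hA, Finset.sum_congr rfl hB, Finset.sum_congr rfl hC]
  simp only [Finset.sum_const, Finset.card_range, nsmul_eq_mul]
  have e1 : m + 5 - (m + 4) = 1 := by omega
  have e2 : m + 5 - (m + 3) = 2 := by omega
  have e3 : m + 4 - (m + 3) = 1 := by omega
  have e4 : m + 5 - (m + 5) = 0 := by omega
  have e5 : m + 4 - (m + 4) = 0 := by omega
  have e6 : m + 3 - (m + 3) = 0 := by omega
  simp [CE, TT, WW, GG, rl, e1, e2, e3]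
  field_simp
  ring

/-- Lattice points. -/
def PP (q : Fin 3 → E2) (l : ℕ) (p : ℕ × ℕ) : E2 :=
  q 0 + ((p.1 : ℝ) / l) • (q 1 - q 0) + ((p.2 : ℝ) / l) • (q 2 - q 0)

theorem E0_eq (q : Fin 3 → E2) (u : E2 → ℝ) : E0 q u u = TT (u (q 0)) (u (q 1)) (u (q 2)) := by
  simp [E0, TT, Fin.sum_univ_three]; ring

theorem E0_fmap (q : Fin 3 → E2) (l : ℕ) (v : E2 → ℝ) (i : ℕ × ℕ) :
    E0 q (v ∘ fmap q l i) (v ∘ fmap q l i) = CE (v ∘ PP q l) i := by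
  rw [E0_eq]
  have h0 : fmap q l i (q 0) = PP q l i := by simp [fmap, PP]
  have h1 : fmap q l i (q 1) = PP q l (i.1 + 1, i.2) := by
    simp only [fmap, PP]; push_cast; rw [add_div, add_smul, one_div]; abel
  have h2 : fmap q l i (q 2) = PP q l (i.1, i.2 + 1) := by
    simp only [fmap, PP]; push_cast; rw [add_div, add_smul, one_div]; abel
  simp only [CE, Function.comp, h0, h1, h2]

theorem PP_inj (q : Fin 3 → E2) (hq : ∀ j k : Fin 3, j ≠ k → dist (q j) (q k) = 1)
    (l : ℕ) (hl : 0 < l) : Function.Injective (PP q l) := by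
  have n1 : ‖q 1 - q 0‖ = 1 := by rw [← dist_eq_norm]; exact hq 1 0 (by decide)
  have n2 : ‖q 2 - q 0‖ = 1 := by rw [← dist_eq_norm]; exact hq 2 0 (by decide)
  have n3 : ‖(q 1 - q 0) - (q 2 - q 0)‖ = 1 := by
    rw [sub_sub_sub_cancel_right, ← dist_eq_norm]; exact hq 1 2 (by decide)
  have ip : inner ℝ (q 1 - q 0) (q 2 - q 0) = (1 : ℝ) / 2 := by
    have := norm_sub_sq_real (q 1 - q 0) (q 2 - q 0)
    rw [n1, n2, n3] at this
    linarith
  rintro ⟨a, b⟩ ⟨c, d⟩ h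
  simp only [PP] at h
  have hl' : (l : ℝ) ≠ 0 := by positivity
  have hz : (((a : ℝ) - c) / l) • (q 1 - q 0) + (((b : ℝ) - d) / l) • (q 2 - q 0) = 0 := by
    rw [sub_div, sub_div, sub_smul, sub_smul]
    have h' := sub_eq_zero.mpr h
    rw [← h']
    abel
  have hn := norm_add_sq_real ((((a : ℝ) - c) / l) • (q 1 - q 0)) ((((b : ℝ) - d) / l) • (q 2 - q 0))
  rw [hz, norm_smul, norm_smul, n1, n2, inner_smul_left, inner_smul_right, ip] at hn
  simp only [norm_zero, mul_one, Real.norm_eq_abs, sq_abs, conj_trivial] at hn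
  set x := ((a : ℝ) - c) / l with hx
  set y := ((b : ℝ) - d) / l with hy
  have x0 : x = 0 := by nlinarith [sq_nonneg (x + y), sq_nonneg x, sq_nonneg y]
  have y0 : y = 0 := by nlinarith [sq_nonneg (x + y), sq_nonneg x, sq_nonneg y]
  rw [hx, div_eq_zero_iff, or_iff_left hl', sub_eq_zero] at x0
  rw [hy, div_eq_zero_iff, or_iff_left hl', sub_eq_zero] at y0
  exact Prod.ext (by exact_mod_cast x0) (by exact_mod_cast y0)

theorem PP_corner (q : Fin 3 → E2) (l : ℕ) (hl : 0 < l) :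
    PP q l (0,0) = q 0 ∧ PP q l (l,0) = q 1 ∧ PP q l (0,l) = q 2 := by
  have hl' : (l : ℝ) ≠ 0 := by positivity
  simp [PP, hl']

theorem finsum_eq (q : Fin 3 → E2) (m : ℕ) (v : E2 → ℝ) :
    (∑ᶠ i ∈ Sset (m+5), E0 q (v ∘ fmap q (m+5) i) (v ∘ fmap q (m+5) i)) =
      ∑ i ∈ SF m, CE (v ∘ PP q (m+5)) i := by
  simp only [E0_fmap, ← SF_eq]
  exact finsum_mem_coe_finset _ _

/-- The minimum of `∑_{i∈S_l} E⁰(v∘f^l_i, v∘f^l_i)` over all `v`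
with `v|_{V₀} = u` is attained and equals `r_l · E⁰(u,u)`. -/
theorem stmt2 (q : Fin 3 → E2) (hq : ∀ j k : Fin 3, j ≠ k → dist (q j) (q k) = 1)
    (l : ℕ) (hl : 5 ≤ l) (u : E2 → ℝ) :
    ∃ v : E2 → ℝ, Set.EqOn v u (V0 q) ∧
      (∑ᶠ i ∈ Sset l, E0 q (v ∘ fmap q l i) (v ∘ fmap q l i)) = rl l * E0 q u u ∧
      ∀ v' : E2 → ℝ, Set.EqOn v' u (V0 q) →
        rl l * E0 q u u ≤ ∑ᶠ i ∈ Sset l, E0 q (v' ∘ fmap q l i) (v' ∘ fmap q l i) := by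
  obtain ⟨m, rfl⟩ := Nat.exists_eq_add_of_le' hl
  obtain ⟨p0, p1, p2⟩ := PP_corner q (m+5) (by omega)
  have inj := PP_inj q hq (m+5) (by omega)
  obtain ⟨w0, w1, w2⟩ := WW_corner m (u (q 0)) (u (q 1)) (u (q 2))
  have hcomp : Function.extend (PP q (m+5)) (WW (m+5) (u (q 0)) (u (q 1)) (u (q 2))) 0 ∘ PP q (m+5)
      = WW (m+5) (u (q 0)) (u (q 1)) (u (q 2)) := Function.extend_comp inj _ _
  refine ⟨Function.extend (PP q (m+5)) (WW (m+5) (u (q 0)) (u (q 1)) (u (q 2))) 0, ?_, ?_, ?_⟩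
  · rintro _ ⟨j, rfl⟩
    fin_cases j
    · have := congrFun hcomp (0,0)
      rw [w0, Function.comp, p0] at this; exact this
    · have := congrFun hcomp (m+5,0)
      rw [w1, Function.comp, p1] at this; exact this
    · have := congrFun hcomp (0,m+5)
      rw [w2, Function.comp, p2] at this; exact this
  · rw [finsum_eq, hcomp, WW_energy, E0_eq]
  · intro v' hv'
    rw [finsum_eq, E0_eq, ← hv' ⟨0, rfl⟩, ← hv' ⟨1, rfl⟩, ← hv' ⟨2, rfl⟩]
    have := lower m (v' ∘ PP q (m+5))
    simpa only [Function.comp, p0, p1, p2] using this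
end
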